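/- Let n ≥ 1 be an integer. For each 0 ≤ d ≤ n, the space S_{n,d} is a finite-dimensional complex vector space and dim S_{n,d} = dim S_{n,n−d}. In fact, the map sending ρ_1 ∈ S_{n,d} to the unique polynomial ρ_2 with ρ_1 ∼_n ρ_2 is a linear isomorphism from S_{n,d} onto S_{n,n−d}. -/

import Mathlib

open MvPolynomial

/-- The jet inversion: given the jets `a j = x^{(j)}(t₀)` of a function `x` with
`x(t₀) ≠ 0`, `iota a j = (1/x)^{(j)}(t₀)`, defined by `iota a 0 = 1 / a 0` and the
recursion `∑_{j=0}^{k} (k.choose j) * a j * iota a (k - j) = 0` for `k ≥ 1`. -/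
noncomputable def iota (a : ℕ → ℂ) : ℕ → ℂ
  | 0 => 1 / a 0
  | (k+1) => -(1 / a 0) * ∑ j ∈ Finset.range (k+1),
      ((k+1).choose (j+1) : ℂ) * a (j+1) * iota a (k - j)
  termination_by k => k
  decreasing_by exact Nat.lt_succ_of_le (Nat.sub_le k j)

/-- `JetRel n ρ₁ ρ₂` means `ρ₁ ∼ₙ ρ₂`:  `ρ₁(a) = a₀ⁿ ρ₂(ιₙ(a))` whenever `a₀ ≠ 0`. -/
def JetRel (n : ℕ) (ρ₁ ρ₂ : MvPolynomial ℕ ℂ) : Prop :=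
  ∀ a : ℕ → ℂ, a 0 ≠ 0 → eval a ρ₁ = (a 0) ^ n * eval (iota a) ρ₂

/-- The space `Sₙ` of polynomials `ρ₁ ∈ ℂ[x₀, …, x_{n-1}]` such that `ρ₁ ∼ₙ ρ₂` for some
polynomial `ρ₂ ∈ ℂ[x₀, …, x_{n-1}]`. -/
noncomputable def Sn (n : ℕ) : Submodule ℂ (MvPolynomial ℕ ℂ) where
  carrier := {ρ₁ | ρ₁ ∈ supported ℂ (Set.Iio n) ∧
    ∃ ρ₂ ∈ supported ℂ (Set.Iio n), JetRel n ρ₁ ρ₂}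
  add_mem' := by
    rintro p q ⟨hp, p₂, hp₂, hrp⟩ ⟨hq, q₂, hq₂, hrq⟩
    refine ⟨add_mem hp hq, p₂ + q₂, add_mem hp₂ hq₂, fun a ha => ?_⟩
    simp only [map_add, hrp a ha, hrq a ha, mul_add]
  zero_mem' := ⟨zero_mem _, 0, zero_mem _, fun a ha => by simp⟩
  smul_mem' := by
    rintro c p ⟨hp, p₂, hp₂, hrp⟩
    refine ⟨Subalgebra.smul_mem _ hp c, c • p₂, Subalgebra.smul_mem _ hp₂ c, fun a ha => ?_⟩
    simp only [MvPolynomial.smul_eq_C_mul, map_mul, eval_C, hrp a ha]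
    ring

/-- `S_{n,d}`: the homogeneous degree-`d` part of `Sₙ`. -/
noncomputable def Snd (n d : ℕ) : Submodule ℂ (MvPolynomial ℕ ℂ) :=
  Sn n ⊓ homogeneousSubmodule ℕ ℂ d

/-- `S_{n,d,l}`: the part of `S_{n,d}` of weighted degree `l`, where variable `xᵢ`
has weight `i`. -/
noncomputable def Sndl (n d l : ℕ) : Submodule ℂ (MvPolynomial ℕ ℂ) :=
  Snd n d ⊓ weightedHomogeneousSubmodule ℂ (fun i : ℕ => i) l

/-- The exponential generating series of a jet. -/
noncomputable def jetSeries (a : ℕ → ℂ) : PowerSeries ℂ :=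
  PowerSeries.mk fun k => a k / (k.factorial : ℂ)

theorem jetSeries_injective : Function.Injective jetSeries := by
  intro a b h
  funext k
  have hk := congrArg (PowerSeries.coeff k) h
  simp only [jetSeries, PowerSeries.coeff_mk] at hk
  exact (div_left_inj' (Nat.cast_ne_zero.mpr k.factorial_ne_zero)).mp hk

theorem jetSeries_smul (c : ℂ) (a : ℕ → ℂ) : jetSeries (c • a) = c • jetSeries a := by
  ext k
  simp [jetSeries, mul_div_assoc]

theorem iota_zero (a : ℕ → ℂ) : iota a 0 = 1 / a 0 := by
  rw [iota]

theorem iota_zero_ne_zero {a : ℕ → ℂ} (ha : a 0 ≠ 0) : iota a 0 ≠ 0 := by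
  rw [iota_zero]
  exact one_div_ne_zero ha

theorem jetSeries_mul_iota {a : ℕ → ℂ} (ha : a 0 ≠ 0) :
    jetSeries a * jetSeries (iota a) = 1 := by
  ext k
  rw [PowerSeries.coeff_mul, Finset.Nat.sum_antidiagonal_eq_sum_range_succ_mk]
  simp only [jetSeries, PowerSeries.coeff_mk, PowerSeries.coeff_one]
  cases k with
  | zero => simp [iota_zero, ha]
  | succ k =>
    have key : ∀ j ∈ Finset.range (k + 1).succ,
        a j / (j.factorial : ℂ) * (iota a (k + 1 - j) / ((k + 1 - j).factorial : ℂ)) =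
          ((k + 1).choose j * a j * iota a (k + 1 - j)) / ((k + 1).factorial : ℂ) := by
      intro j hj
      rw [Nat.cast_choose ℂ (Nat.lt_succ_iff.mp (Finset.mem_range.mp hj))]
      have h1 : (j.factorial : ℂ) ≠ 0 := Nat.cast_ne_zero.mpr j.factorial_ne_zero
      have h2 : ((k + 1 - j).factorial : ℂ) ≠ 0 :=
        Nat.cast_ne_zero.mpr (Nat.factorial_ne_zero _)
      have h3 : ((k + 1).factorial : ℂ) ≠ 0 := Nat.cast_ne_zero.mpr (Nat.factorial_ne_zero _)
      field_simp
    rw [Finset.sum_congr rfl key, ← Finset.sum_div, Finset.sum_range_succ']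
    simp only [Nat.choose_zero_right, Nat.sub_zero, Nat.add_sub_add_right]
    rw [iota]
    simp only [Nat.cast_one, one_mul, Nat.succ_ne_zero, if_false]
    field_simp
    ring

theorem iota_eq_of_jetSeries_mul {a b : ℕ → ℂ} (ha : a 0 ≠ 0)
    (h : jetSeries a * jetSeries b = 1) : iota a = b := by
  apply jetSeries_injective
  have := jetSeries_mul_iota ha
  calc jetSeries (iota a) = jetSeries (iota a) * (jetSeries a * jetSeries b) := by rw [h, mul_one]
    _ = (jetSeries a * jetSeries (iota a)) * jetSeries b := by ring
    _ = jetSeries b := by rw [this, one_mul]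

theorem iota_iota {a : ℕ → ℂ} (ha : a 0 ≠ 0) : iota (iota a) = a :=
  iota_eq_of_jetSeries_mul (iota_zero_ne_zero ha) (by rw [mul_comm, jetSeries_mul_iota ha])

theorem iota_smul {c : ℂ} (hc : c ≠ 0) {a : ℕ → ℂ} (ha : a 0 ≠ 0) :
    iota (c • a) = c⁻¹ • iota a := by
  apply iota_eq_of_jetSeries_mul (by simp [hc, ha])
  rw [jetSeries_smul, jetSeries_smul, smul_mul_smul_comm, jetSeries_mul_iota ha,
    mul_inv_cancel₀ hc, one_smul]

theorem JetRel.symm {n : ℕ} {p q : MvPolynomial ℕ ℂ} (h : JetRel n p q) : JetRel n q p := by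
  intro a ha
  rw [h _ (iota_zero_ne_zero ha), iota_iota ha, iota_zero, ← mul_assoc, ← mul_pow,
    mul_one_div_cancel ha, one_pow, one_mul]

theorem eq_of_eval_eq_of_zero_ne_zero {p q : MvPolynomial ℕ ℂ}
    (h : ∀ a : ℕ → ℂ, a 0 ≠ 0 → eval a p = eval a q) : p = q := by
  apply mul_left_cancel₀ (X_ne_zero (R := ℂ) (0 : ℕ))
  apply MvPolynomial.funext
  intro a
  by_cases ha : a 0 = 0
  · simp [ha]
  · simp [h a ha]

theorem JetRel.right_unique {n : ℕ} {p q r : MvPolynomial ℕ ℂ} (hq : JetRel n p q)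
    (hr : JetRel n p r) : q = r :=
  eq_of_eval_eq_of_zero_ne_zero fun a ha => by rw [hq.symm a ha, hr.symm a ha]

theorem JetRel.add {n : ℕ} {p q p' q' : MvPolynomial ℕ ℂ} (h : JetRel n p q)
    (h' : JetRel n p' q') : JetRel n (p + p') (q + q') := fun a ha => by
  simp only [map_add, h a ha, h' a ha, mul_add]

theorem JetRel.smul {n : ℕ} {p q : MvPolynomial ℕ ℂ} (c : ℂ) (h : JetRel n p q) :
    JetRel n (c • p) (c • q) := fun a ha => by
  simp only [smul_eval, h a ha]
  ring

theorem coeff_aeval_C_mul_X (c : ℂ) (p : MvPolynomial ℕ ℂ) (m : ℕ →₀ ℕ) :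
    coeff m (aeval (fun i => C c * X i : ℕ → MvPolynomial ℕ ℂ) p) =
      c ^ m.degree * coeff m p := by
  induction p using MvPolynomial.induction_on' with
  | add p q hp hq => simp only [map_add, coeff_add, hp, hq, mul_add]
  | monomial u r =>
    have : aeval (fun i => C c * X i : ℕ → MvPolynomial ℕ ℂ) (monomial u r) =
        monomial u (c ^ u.degree * r) := by
      rw [aeval_monomial, monomial_eq, algebraMap_eq, C_mul, C_pow, Finsupp.degree_apply]
      simp only [Finsupp.prod, mul_pow, Finset.prod_mul_distrib, Finset.prod_pow_eq_pow_sum]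
      ring
    rw [this, coeff_monomial, coeff_monomial]
    split_ifs with h
    · rw [h]
    · rw [mul_zero]

theorem isHomogeneous_of_eval_two_smul {p : MvPolynomial ℕ ℂ} {e : ℕ}
    (h : ∀ a : ℕ → ℂ, a 0 ≠ 0 → eval ((2 : ℂ) • a) p = 2 ^ e * eval a p) :
    p.IsHomogeneous e := by
  have hp : aeval (fun i => C 2 * X i : ℕ → MvPolynomial ℕ ℂ) p = C (2 ^ e) * p := by
    apply eq_of_eval_eq_of_zero_ne_zero
    intro a ha
    rw [map_mul, eval_C, ← h a ha, ← coe_aeval_eq_eval, ← coe_aeval_eq_eval, RingHom.coe_coe,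
      RingHom.coe_coe, ← AlgHom.comp_apply, comp_aeval]
    congr 2
    funext i
    simp
  intro m hm
  have hc := congrArg (coeff m) hp
  rw [coeff_aeval_C_mul_X, coeff_C_mul] at hc
  have h2 : ((2 ^ m.degree : ℕ) : ℂ) = ((2 ^ e : ℕ) : ℂ) := by
    push_cast
    exact mul_right_cancel₀ hm hc
  change Finsupp.weight (fun _ => 1) m = e
  rw [← Finsupp.degree_eq_weight_one]
  exact Nat.pow_right_injective le_rfl (Nat.cast_injective h2)

theorem eval_smul_of_isHomogeneous {p : MvPolynomial ℕ ℂ} {d : ℕ} (hp : p.IsHomogeneous d)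
    (c : ℂ) (a : ℕ → ℂ) : eval (c • a) p = c ^ d * eval a p := by
  rw [eval_eq, eval_eq, Finset.mul_sum]
  refine Finset.sum_congr rfl fun m hm => ?_
  have hdeg : m.degree = d := by
    rw [Finsupp.degree_eq_weight_one]
    exact hp (mem_support_iff.mp hm)
  simp only [Pi.smul_apply, smul_eq_mul, mul_pow, Finset.prod_mul_distrib,
    Finset.prod_pow_eq_pow_sum]
  rw [← hdeg, Finsupp.degree_apply]
  ring

theorem JetRel.isHomogeneous {n d : ℕ} (hd : d ≤ n) {p q : MvPolynomial ℕ ℂ}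
    (h : JetRel n p q) (hp : p.IsHomogeneous d) : q.IsHomogeneous (n - d) := by
  apply isHomogeneous_of_eval_two_smul
  intro a ha
  have h2 : (2 : ℂ) ≠ 0 := two_ne_zero
  rw [h.symm _ (by simp [ha]), h.symm a ha, iota_smul h2 ha, eval_smul_of_isHomogeneous hp,
    pow_sub₀ _ h2 hd, Pi.smul_apply, smul_eq_mul, mul_pow, inv_pow]
  ring

theorem Snd.exists_jetRel {n d : ℕ} (hd : d ≤ n) {p : MvPolynomial ℕ ℂ} (hp : p ∈ Snd n d) :
    ∃ q ∈ Snd n (n - d), JetRel n p q := by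
  obtain ⟨⟨hp, q, hq, h⟩, hhom⟩ := hp
  exact ⟨q, ⟨⟨hq, p, hp, h.symm⟩, h.isHomogeneous hd hhom⟩, h⟩

theorem finiteDimensional_Snd (n d : ℕ) : FiniteDimensional ℂ (Snd n d) := by
  classical
  refine Submodule.finiteDimensional_of_le (S₂ := Submodule.span ℂ
    (((Finset.range n).finsuppAntidiag d).image (fun m => monomial m (1 : ℂ)) :
      Finset (MvPolynomial ℕ ℂ))) ?_
  rintro p ⟨⟨hp, -⟩, hhom⟩
  rw [p.as_sum]
  refine Submodule.sum_mem _ fun m hm => ?_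
  rw [← mul_one (coeff m p), ← smul_eq_mul, ← smul_monomial]
  refine Submodule.smul_mem _ _ (Submodule.subset_span ?_)
  simp only [Finset.coe_image]
  refine ⟨m, ?_, rfl⟩
  have hsupp : m.support ⊆ Finset.range n := by
    intro i hi
    have := mem_supported.mp hp (Finset.mem_coe.mpr (mem_vars_iff_mem_support i |>.mpr ⟨m, hm, hi⟩))
    simpa using this
  have hdeg : m.degree = d := by
    rw [Finsupp.degree_eq_weight_one]
    exact hhom (mem_support_iff.mp hm)
  exact Finset.mem_coe.mpr (Finset.mem_finsuppAntidiag'.mpr ⟨hdeg, hsupp⟩)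


/-- Let `n ≥ 1` and `0 ≤ d ≤ n`. The space `S_{n,d}` is finite dimensional over `ℂ` and
`dim S_{n,d} = dim S_{n,n−d}`; indeed the map sending `ρ₁ ∈ S_{n,d}` to the unique
polynomial `ρ₂` with `ρ₁ ∼ₙ ρ₂` is a linear isomorphism `S_{n,d} ≃ S_{n,n−d}`. -/
theorem stmt12 (n : ℕ) (hn : 1 ≤ n) (d : ℕ) (hd : d ≤ n) :
    FiniteDimensional ℂ ↥(Snd n d) ∧
    Module.finrank ℂ ↥(Snd n d) = Module.finrank ℂ ↥(Snd n (n - d)) ∧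
    ∃ e : ↥(Snd n d) ≃ₗ[ℂ] ↥(Snd n (n - d)),
      ∀ ρ : ↥(Snd n d), JetRel n (ρ : MvPolynomial ℕ ℂ) ((e ρ : MvPolynomial ℕ ℂ)) := by
  have hex (p : Snd n d) : ∃ q : Snd n (n - d), JetRel n p q := by
    obtain ⟨q, hq, h⟩ := Snd.exists_jetRel hd p.2
    exact ⟨⟨q, hq⟩, h⟩
  choose f hf using hex
  let L : Snd n d →ₗ[ℂ] Snd n (n - d) :=
    { toFun := f
      map_add' := fun p q => Subtype.ext <|
        (hf (p + q)).right_unique ((hf p).add (hf q))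
      map_smul' := fun c p => Subtype.ext <|
        (hf (c • p)).right_unique ((hf p).smul c) }
  have hL : Function.Bijective L := by
    constructor
    · intro p q hpq
      have hq := (hf q).symm
      rw [← show f p = f q from hpq] at hq
      exact Subtype.ext ((hf p).symm.right_unique hq)
    · intro q
      obtain ⟨p, hp, h⟩ := Snd.exists_jetRel (Nat.sub_le n d) q.2
      rw [Nat.sub_sub_self hd] at hp
      exact ⟨⟨p, hp⟩, Subtype.ext ((hf _).right_unique h.symm)⟩
  let e := LinearEquiv.ofBijective L hL
  exact ⟨finiteDimensional_Snd n d, e.finrank_eq, e, hf⟩
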